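/- For every d ≥ 1 and every l ≥ 3, the non-(l)-overlapping condition is not preserved by the operadic composition of the operad C_d^∞: there exist n, m, an index i, a non-(l)-overlapping configuration c of n little cubes and a non-(l)-overlapping configuration c' of m little cubes such that the operadic composite c ∘_i c' is not non-(l)-overlapping. Explicitly, taking n = m = l - 1 and every cube equal to the identity little cube, both configurations are (vacuously) non-(l)-overlapping, while the composite at the first slot consists of 2l - 3 ≥ l copies of the identity cube, whose interiors have nonempty l-fold intersection. (Hence the sequence C_d^{(l)} is a bimodule over C_d but does not inherit an operad structure from C_d^∞.) -/

import Mathlib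

/-- The closed unit cube `K_d ⊆ ℝ^d`. -/
def unitCube (d : ℕ) : Set (Fin d → ℝ) := {t | ∀ i, 0 ≤ t i ∧ t i ≤ 1}

/-- A `d`-dimensional little cube. -/
def IsLittleCube (d : ℕ) (c : (Fin d → ℝ) → (Fin d → ℝ)) : Prop :=
  ∃ a b : Fin d → ℝ, (∀ i, 0 < b i) ∧ (∀ t i, c t i = a i + b i * t i) ∧
    ∀ t ∈ unitCube d, c t ∈ unitCube d

/-- The image of a little cube. -/
def Im {d : ℕ} (c : (Fin d → ℝ) → (Fin d → ℝ)) : Set (Fin d → ℝ) :=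
  c '' unitCube d

/-- A configuration of little cubes indexed by `J` is non-`(l)`-overlapping if
any `l` distinct cube interiors have empty intersection. -/
def NonOverlapping (d l : ℕ) {J : Type*}
    (c : J → (Fin d → ℝ) → (Fin d → ℝ)) : Prop :=
  ∀ σ : Fin l → J, Function.Injective σ →
    (⋂ j : Fin l, interior (Im (c (σ j)))) = ∅

theorem isLittleCube_id (d : ℕ) : IsLittleCube d id :=
  ⟨0, 1, fun _ => one_pos, fun t i => by simp, fun _ ht => ht⟩

theorem half_mem_interior_unitCube (d : ℕ) :
    (fun _ => 1 / 2 : Fin d → ℝ) ∈ interior (unitCube d) := by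
  have h : unitCube d = Set.univ.pi fun _ => Set.Icc (0 : ℝ) 1 := by
    ext t
    simp only [unitCube, Set.mem_ofPred_eq, Set.mem_univ_pi, Set.mem_Icc]
  rw [h, interior_pi_set Set.finite_univ]
  simp only [interior_Icc, Set.mem_pi, Set.mem_Ioo]
  intro i _
  norm_num

/-- The condition is vacuous for fewer than `l` cubes. -/
theorem nonOverlapping_of_card_lt {d l : ℕ} {J : Type*} [Fintype J]
    (c : J → (Fin d → ℝ) → (Fin d → ℝ)) (h : Fintype.card J < l) :
    NonOverlapping d l c := by
  intro σ hσ
  have := Fintype.card_le_of_injective σ hσ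
  rw [Fintype.card_fin] at this
  omega

/-- At least `l` copies of the identity cube overlap. -/
theorem not_nonOverlapping_of_forall_eq_id {d l : ℕ} {J : Type*} [Fintype J]
    {c : J → (Fin d → ℝ) → (Fin d → ℝ)} (hc : ∀ j, c j = id) (h : l ≤ Fintype.card J) :
    ¬ NonOverlapping d l c := by
  intro hno
  obtain ⟨σ⟩ : Nonempty (Fin l ↪ J) :=
    Function.Embedding.nonempty_of_card_le (by simpa using h)
  have hmem : (fun _ => 1 / 2 : Fin d → ℝ) ∈ ⋂ j : Fin l, interior (Im (c (σ j))) := by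
    simpa only [hc, Im, Set.image_id, Set.mem_iInter] using
      fun _ => half_mem_interior_unitCube d
  rw [hno σ σ.injective] at hmem
  exact hmem

/-- for every `d ≥ 1` and `l ≥ 3`, the non-`(l)`-overlapping
condition is not preserved by operadic composition; witnesses are given by
`n = m = l - 1` configurations of identity little cubes. -/
theorem nonOverlapping_not_operad {d l : ℕ} (hd : 1 ≤ d) (hl : 3 ≤ l) :
    ∃ (n m : ℕ) (i : Fin n)
      (c : Fin n → (Fin d → ℝ) → (Fin d → ℝ))
      (c' : Fin m → (Fin d → ℝ) → (Fin d → ℝ)),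
      n = l - 1 ∧ m = l - 1 ∧
      (∀ j, c j = id) ∧ (∀ j, c' j = id) ∧
      (∀ j, IsLittleCube d (c j)) ∧ (∀ j, IsLittleCube d (c' j)) ∧
      NonOverlapping d l c ∧ NonOverlapping d l c' ∧
      ¬ NonOverlapping d l
        (fun x : {k : Fin n // k ≠ i} ⊕ Fin m =>
          Sum.elim (fun k : {k : Fin n // k ≠ i} => c k.1)
            (fun j : Fin m => c i ∘ c' j) x) := by
  refine ⟨l - 1, l - 1, ⟨0, by omega⟩, fun _ => id, fun _ => id, rfl, rfl,
    fun _ => rfl, fun _ => rfl, fun _ => isLittleCube_id d, fun _ => isLittleCube_id d,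
    nonOverlapping_of_card_lt _ (by rw [Fintype.card_fin]; omega),
    nonOverlapping_of_card_lt _ (by rw [Fintype.card_fin]; omega),
    not_nonOverlapping_of_forall_eq_id (by rintro (_ | _) <;> rfl) ?_⟩
  rw [Fintype.card_sum, Fintype.card_subtype_compl, Fintype.card_fin, Fintype.card_subtype_eq]
  omega
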